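/- Let H1 and H2 be complex Hilbert spaces with H1 nontrivial, and let T : H1 → H2 be a bounded linear operator. Then m(T) ∈ σ(|T|), where |T| := (T*T)^{1/2} is the modulus of T. In particular, if T : H → H is a bounded positive operator on a nontrivial complex Hilbert space, then m(T) ∈ σ(T). -/

import Mathlib

open ContinuousLinearMap

universe u

variable {H1 H2 : Type*} [NormedAddCommGroup H1] [InnerProductSpace ℂ H1] [CompleteSpace H1]
  [NormedAddCommGroup H2] [InnerProductSpace ℂ H2] [CompleteSpace H2]

/-- The minimum modulus of a bounded operator. -/
noncomputable def mB (T : H1 →L[ℂ] H2) : ℝ :=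
  sInf {r : ℝ | ∃ x : H1, ‖x‖ = 1 ∧ ‖T x‖ = r}

/-- The modulus `|T| = (T*T)^{1/2}`, the positive square root of `T*T`
given by the continuous functional calculus. -/
noncomputable def modulusCLM (T : H1 →L[ℂ] H2) : H1 →L[ℂ] H1 :=
  cfc Real.sqrt (adjoint T ∘L T)

omit [CompleteSpace H1] [CompleteSpace H2] in
theorem mB_le_norm_apply (T : H1 →L[ℂ] H2) {x : H1} (hx : ‖x‖ = 1) : mB T ≤ ‖T x‖ :=
  csInf_le ⟨0, by rintro _ ⟨y, -, rfl⟩; exact norm_nonneg _⟩ ⟨x, hx, rfl⟩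

omit [CompleteSpace H1] [CompleteSpace H2] in
theorem mB_mul_norm_le (T : H1 →L[ℂ] H2) (x : H1) : mB T * ‖x‖ ≤ ‖T x‖ := by
  rcases eq_or_ne x 0 with rfl | hx
  · simp
  have hpos : 0 < ‖x‖ := norm_pos_iff.2 hx
  have h := mB_le_norm_apply T (x := ((‖x‖⁻¹ : ℝ) : ℂ) • x)
    (by rw [norm_smul, Complex.norm_real, norm_inv, norm_norm, inv_mul_cancel₀ hpos.ne'])
  rw [map_smul, norm_smul, Complex.norm_real, norm_inv, norm_norm, ← div_eq_inv_mul,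
    le_div_iff₀ hpos] at h
  exact h

omit [CompleteSpace H1] [CompleteSpace H2] in
theorem le_mB [Nontrivial H1] (T : H1 →L[ℂ] H2) {c : ℝ} (h : ∀ x, ‖x‖ = 1 → c ≤ ‖T x‖) :
    c ≤ mB T := by
  obtain ⟨x, hx⟩ := exists_norm_eq H1 zero_le_one
  refine le_csInf ⟨_, x, hx, rfl⟩ ?_
  rintro _ ⟨y, hy, rfl⟩
  exact h y hy

/-- A self-adjoint operator that is bounded below is invertible. -/
theorem IsSelfAdjoint.isUnit_of_mul_norm_le {A : H1 →L[ℂ] H1} (hA : IsSelfAdjoint A) {c : ℝ}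
    (hc : 0 < c) (h : ∀ x, c * ‖x‖ ≤ ‖A x‖) : IsUnit A := by
  rw [← isUnit_pow_iff two_ne_zero]
  refine isUnit_of_forall_le_norm_inner_map (c := ⟨c ^ 2, by positivity⟩) _
    (show (0 : ℝ) < c ^ 2 by positivity) fun x => ?_
  have key : inner ℂ ((A ^ 2) x) x = ((‖A x‖ ^ 2 : ℝ) : ℂ) := by
    rw [pow_two, mul_apply_eq_comp, hA.isSymmetric.apply_clm, inner_self_eq_norm_sq_to_K]
    simp
  rw [key, Complex.norm_real, Real.norm_of_nonneg (by positivity)]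
  calc ‖x‖ ^ 2 * c ^ 2 = (c * ‖x‖) ^ 2 := by ring
    _ ≤ ‖A x‖ ^ 2 := by gcongr; exact h x

theorem ContinuousLinearMap.IsPositive.mB_mem_spectrum [Nontrivial H1] {S : H1 →L[ℂ] H1}
    (hS : S.IsPositive) : ((mB S : ℝ) : ℂ) ∈ spectrum ℂ S := by
  have hsa : IsSelfAdjoint S := hS.isSelfAdjoint
  have h0 : 0 ≤ S := (nonneg_iff_isPositive S).2 hS
  obtain ⟨d, hd, hmin⟩ := (spectrum.isCompact (𝕜 := ℝ) S).exists_isLeast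
    (ContinuousFunctionalCalculus.spectrum_nonempty (R := ℝ) S hsa)
  have hd0 : 0 ≤ d := spectrum_nonneg_of_nonneg h0 hd
  have hle : algebraMap ℝ (H1 →L[ℂ] H1) d ≤ S :=
    algebraMap_le_of_le_spectrum (fun x hx => hmin hx) hsa
  have hpos : (S - algebraMap ℝ (H1 →L[ℂ] H1) d).IsPositive := (le_def _ _).1 hle
  have lower : d ≤ mB S := by
    refine le_mB S fun x hx => ?_
    have h1 := hpos.re_inner_nonneg_left x
    have h2 : RCLike.re (inner ℂ (S x) x) ≤ ‖S x‖ := by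
      simpa [hx] using re_inner_le_norm (𝕜 := ℂ) (S x) x
    have h3 : RCLike.re (inner ℂ ((algebraMap ℝ (H1 →L[ℂ] H1) d) x) x) = d := by
      rw [Algebra.algebraMap_eq_smul_one, smul_apply, one_apply_eq_self,
        ← Complex.coe_smul, inner_smul_left]
      simp [hx]
    rw [sub_apply, inner_sub_left, map_sub, h3] at h1
    linarith
  have upper : mB S ≤ d := by
    by_contra! hlt
    refine hd (spectrum.mem_resolventSet_iff.2 ?_)
    rw [← neg_sub, IsUnit.neg_iff]
    refine hpos.isSelfAdjoint.isUnit_of_mul_norm_le (sub_pos.2 hlt) fun x => ?_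
    have h1 := mB_mul_norm_le S x
    have h2 := norm_sub_norm_le (S x) (d • x)
    rw [norm_smul, Real.norm_of_nonneg hd0] at h2
    rw [sub_apply, Algebra.algebraMap_eq_smul_one, smul_apply, one_apply_eq_self]
    linarith
  rw [le_antisymm upper lower]
  exact (spectrum.algebraMap_mem_iff ℂ).2 hd

theorem modulusCLM_isPositive (T : H1 →L[ℂ] H2) : (modulusCLM T).IsPositive :=
  (nonneg_iff_isPositive _).1 (cfc_nonneg fun x _ => Real.sqrt_nonneg x)

theorem modulusCLM_mul_self (T : H1 →L[ℂ] H2) :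
    modulusCLM T * modulusCLM T = adjoint T ∘L T := by
  have hpos : (adjoint T ∘L T).IsPositive := isPositive_adjoint_comp_self T
  have h0 : 0 ≤ adjoint T ∘L T := (nonneg_iff_isPositive _).2 hpos
  rw [modulusCLM, ← cfc_mul Real.sqrt Real.sqrt _]
  conv_rhs => rw [← cfc_id' ℝ (adjoint T ∘L T) hpos.isSelfAdjoint]
  exact cfc_congr fun x hx => Real.mul_self_sqrt (spectrum_nonneg_of_nonneg h0 hx)

theorem norm_modulusCLM_apply (T : H1 →L[ℂ] H2) (x : H1) : ‖modulusCLM T x‖ = ‖T x‖ := by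
  have h : inner ℂ (modulusCLM T x) (modulusCLM T x) = inner ℂ (T x) (T x) := by
    rw [← adjoint_inner_left T, ← comp_apply, ← modulusCLM_mul_self, mul_apply_eq_comp]
    exact ((modulusCLM_isPositive T).isSelfAdjoint.isSymmetric _ _).symm
  rw [norm_eq_sqrt_re_inner (𝕜 := ℂ), h, ← norm_eq_sqrt_re_inner]

theorem mB_modulusCLM (T : H1 →L[ℂ] H2) : mB (modulusCLM T) = mB T := by
  simp only [mB, norm_modulusCLM_apply]

theorem min_modulus_mem_spectrum_modulus [Nontrivial H1] (T : H1 →L[ℂ] H2) :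
    ((mB T : ℝ) : ℂ) ∈ spectrum ℂ (modulusCLM T) ∧
    ∀ (H : Type u) [NormedAddCommGroup H] [InnerProductSpace ℂ H] [CompleteSpace H]
      [Nontrivial H] (S : H →L[ℂ] H), S.IsPositive → ((mB S : ℝ) : ℂ) ∈ spectrum ℂ S := by
  exact ⟨mB_modulusCLM T ▸ (modulusCLM_isPositive T).mB_mem_spectrum,
    fun H _ _ _ _ S hS => hS.mB_mem_spectrum⟩
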